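/- Every violation-complete monitorable property is persistently informatively monitorable: in a maximal monitoring system, if P is a property such that the canonical monitor m_P is violation-complete for P, then for every finite trace t there exists a finfinite trace u such that m_P accepts or rejects t·u. -/

import Mathlib

/-- Finfinite traces over an alphabet `Act`: finite lists or infinite sequences. -/
inductive Trace (Act : Type) : Type where
  | fin : List Act → Trace Act
  | inf : (ℕ → Act) → Trace Act

/-- Concatenation of a finite trace with a finfinite trace. -/
def Trace.cat {Act : Type} (t : List Act) : Trace Act → Trace Act
  | .fin s => .fin (t ++ s)
  | .inf f => .inf (fun n => if h : n < t.length then t.get ⟨n, h⟩ else f (n - t.length))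

/-- A finite trace positively determines `P`: every finfinite extension is in `P`. -/
def PosDet {Act : Type} (P : Set (Trace Act)) (t : List Act) : Prop :=
  ∀ u : Trace Act, Trace.cat t u ∈ P

/-- A finite trace negatively determines `P`: every finfinite extension is not in `P`. -/
def NegDet {Act : Type} (P : Set (Trace Act)) (t : List Act) : Prop :=
  ∀ u : Trace Act, Trace.cat t u ∉ P

/-- A monitoring system: monitors with acceptance/rejection relations satisfying
finite-prefix witnessing and verdict persistence. -/
structure MonSys (Act : Type) where
  M : Type
  acc : M → Trace Act → Prop
  rej : M → Trace Act → Prop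
  acc_prefix : ∀ m u, acc m u → ∃ t : List Act, (∃ v, Trace.cat t v = u) ∧ acc m (Trace.fin t)
  rej_prefix : ∀ m u, rej m u → ∃ t : List Act, (∃ v, Trace.cat t v = u) ∧ rej m (Trace.fin t)
  acc_persist : ∀ m (t : List Act) (u : Trace Act), acc m (Trace.fin t) → acc m (Trace.cat t u)
  rej_persist : ∀ m (t : List Act) (u : Trace Act), rej m (Trace.fin t) → rej m (Trace.cat t u)

/-- Soundness of a monitor for a property. -/
def Sound {Act : Type} (S : MonSys Act) (m : S.M) (P : Set (Trace Act)) : Prop :=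
  (∀ u, S.acc m u → u ∈ P) ∧ (∀ u, S.rej m u → u ∉ P)

/-- The canonical (maximal) monitor for `P`: it accepts exactly the traces with a prefix
positively determining `P`, and rejects exactly those with a prefix negatively determining `P`. -/
def Canonical {Act : Type} (S : MonSys Act) (m : S.M) (P : Set (Trace Act)) : Prop :=
  (∀ u, S.acc m u ↔ ∃ t : List Act, (∃ v, Trace.cat t v = u) ∧ PosDet P t) ∧
  (∀ u, S.rej m u ↔ ∃ t : List Act, (∃ v, Trace.cat t v = u) ∧ NegDet P t)

/-- Safety: every violating trace has a finite prefix negatively determining `P`. -/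
def Safety {Act : Type} (P : Set (Trace Act)) : Prop :=
  ∀ u, u ∉ P → ∃ t : List Act, (∃ v, Trace.cat t v = u) ∧ NegDet P t

/-- Co-safety: every satisfying trace has a finite prefix positively determining `P`. -/
def CoSafety {Act : Type} (P : Set (Trace Act)) : Prop :=
  ∀ u, u ∈ P → ∃ t : List Act, (∃ v, Trace.cat t v = u) ∧ PosDet P t

/-- Universal Pnueli–Zaks monitorability. -/
def UPZ {Act : Type} (P : Set (Trace Act)) : Prop :=
  ∀ t : List Act, ∃ t' : List Act, PosDet P (t ++ t') ∨ NegDet P (t ++ t')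

/-- Existential Pnueli–Zaks monitorability. -/
def EPZ {Act : Type} (P : Set (Trace Act)) : Prop :=
  ∃ t : List Act, PosDet P t ∨ NegDet P t

theorem violationComplete_persistentlyInformative {Act : Type} (S : MonSys Act)
    (mP : S.M) (P : Set (Trace Act)) (hc : Canonical S mP P)
    (hviol : ∀ u, u ∉ P → S.rej mP u) :
    ∀ t : List Act, ∃ u : Trace Act,
      S.acc mP (Trace.cat t u) ∨ S.rej mP (Trace.cat t u) := by
  intro t
  by_cases h : PosDet P t
  · exact ⟨.fin [], Or.inl ((hc.1 _).2 ⟨t, ⟨_, rfl⟩, h⟩)⟩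
  · unfold PosDet at h
    push Not at h
    obtain ⟨u, hu⟩ := h
    exact ⟨u, Or.inr (hviol _ hu)⟩
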